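/- (Forward Hardy inequality for positive power weights, r ≤ s case.) Let 1 ≤ r ≤ s ≤ ∞, a, b slowly varying on (0,∞), μ > 0, κ ∈ ℝ. If sup_{x>0} b(x)/a(x) < ∞, then there exists C > 0 such that for every measurable g : (0,∞) → [0,∞): ‖ t^{−μ−1/s} b(t) ∫₀ᵗ u^{κ−1} g(u) du ‖_{L^s(0,∞)} ≤ C ‖ t^{−μ+κ−1/r} a(t) g(t) ‖_{L^r(0,∞)}. -/

import Mathlib

open MeasureTheory Set Real
open scoped ENNReal

/-- `a` is slowly varying on `I`. -/
def SlowlyVaryingOn (a : ℝ → ℝ) (I : Set ℝ) : Prop :=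
  ∀ ε : ℝ, 0 < ε → ∃ g₁ g₂ : ℝ → ℝ, MonotoneOn g₁ I ∧ AntitoneOn g₂ I ∧
    ∃ c₁ c₂ : ℝ, 0 < c₁ ∧ 0 < c₂ ∧ ∀ t ∈ I,
      c₁ * g₁ t ≤ t ^ ε * a t ∧ t ^ ε * a t ≤ c₂ * g₁ t ∧
      c₁ * g₂ t ≤ t ^ (-ε) * a t ∧ t ^ (-ε) * a t ≤ c₂ * g₂ t

/-- The (extended) Lebesgue `L^s` functional over the set `I` for `ℝ≥0∞`-valued functions,
with `s ∈ [1,∞]`. -/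
noncomputable def elp (s : ℝ≥0∞) (I : Set ℝ) (F : ℝ → ℝ≥0∞) : ℝ≥0∞ :=
  if s = ⊤ then essSup F (MeasureTheory.volume.restrict I)
  else (∫⁻ t in I, F t ^ s.toReal) ^ s.toReal⁻¹

lemma jensen_aux {α : Type*} [MeasurableSpace α] (m : Measure α) (f : α → ℝ≥0∞)
    (hf : Measurable f) (p : ℝ) (hp : 1 ≤ p) :
    (∫⁻ x, f x ∂m) ^ p ≤ m univ ^ (p - 1) * ∫⁻ x, f x ^ p ∂m := by
  have h := eLpNorm'_le_eLpNorm'_mul_rpow_measure_univ (μ := m) (f := f) one_pos hp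
    hf.aestronglyMeasurable
  simp only [eLpNorm'_eq_lintegral_enorm, enorm_eq_self, ENNReal.rpow_one, div_one] at h
  have hp0 : 0 < p := by linarith
  have h2 := ENNReal.rpow_le_rpow h hp0.le
  rw [ENNReal.mul_rpow_of_nonneg _ _ hp0.le, ← ENNReal.rpow_mul, ← ENNReal.rpow_mul,
    one_div_mul_cancel hp0.ne', ENNReal.rpow_one, sub_mul, one_div_mul_cancel hp0.ne', one_mul,
    mul_comm] at h2
  exact h2

lemma lint_Ioo (ν : ℝ) (hν : 0 < ν) (t : ℝ) (ht : 0 < t) :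
    ∫⁻ u in Ioo 0 t, ENNReal.ofReal (u ^ (ν - 1)) = ENNReal.ofReal (t ^ ν / ν) := by
  rw [← ofReal_integral_eq_lintegral_ofReal]
  · rw [← integral_Ioc_eq_integral_Ioo, ← intervalIntegral.integral_of_le ht.le,
      integral_rpow (Or.inl (by linarith))]
    simp [Real.zero_rpow hν.ne']
  · exact (intervalIntegral.integrableOn_Ioo_rpow_iff ht).2 (by linarith)
  · exact (ae_restrict_mem measurableSet_Ioo).mono fun u hu => Real.rpow_nonneg hu.1.le _

lemma lint_Ioi (ν : ℝ) (hν : 0 < ν) (u : ℝ) (hu : 0 < u) :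
    ∫⁻ t in Ioi u, ENNReal.ofReal (t ^ (-ν - 1)) = ENNReal.ofReal (u ^ (-ν) / ν) := by
  rw [← ofReal_integral_eq_lintegral_ofReal]
  · rw [integral_Ioi_rpow_of_lt (by linarith) hu]
    congr 1
    rw [sub_add_cancel, neg_div_neg_eq]
  · exact integrableOn_Ioi_rpow_of_lt (by linarith) hu
  · exact (ae_restrict_mem measurableSet_Ioi).mono fun t ht =>
      Real.rpow_nonneg (hu.trans ht).le _

/-- The Hardy operator, normalised. -/
noncomputable def Hop (ν : ℝ) (G : ℝ → ℝ≥0∞) (t : ℝ) : ℝ≥0∞ :=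
  ENNReal.ofReal (t ^ (-ν)) * ∫⁻ u in Ioo 0 t, ENNReal.ofReal (u ^ (ν - 1)) * G u

lemma meas_w (c : ℝ) : Measurable (fun u : ℝ => ENNReal.ofReal (u ^ c)) := by fun_prop

lemma coreA (ν : ℝ) (hν : 0 < ν) (G : ℝ → ℝ≥0∞) (hG : Measurable G) (p : ℝ) (hp : 1 ≤ p)
    (t : ℝ) (ht : 0 < t) :
    Hop ν G t ^ p ≤ ENNReal.ofReal (ν⁻¹ ^ (p - 1)) * (ENNReal.ofReal (t ^ (-ν)) *
      ∫⁻ u in Ioo 0 t, ENNReal.ofReal (u ^ (ν - 1)) * G u ^ p) := by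
  have hp0 : 0 < p := by linarith
  have h := jensen_aux ((volume.restrict (Ioo 0 t)).withDensity
    (fun u => ENNReal.ofReal (u ^ (ν - 1)))) G hG p hp
  rw [lintegral_withDensity_eq_lintegral_mul _ (meas_w _) hG,
    lintegral_withDensity_eq_lintegral_mul _ (meas_w _) (hG.pow_const p),
    withDensity_apply _ MeasurableSet.univ, Measure.restrict_univ, lint_Ioo ν hν t ht] at h
  simp only [Pi.mul_apply] at h
  unfold Hop
  rw [ENNReal.mul_rpow_of_nonneg _ _ hp0.le]
  refine (mul_le_mul_right h _).trans (le_of_eq ?_)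
  have htp : 0 < t ^ (-ν) := Real.rpow_pos_of_pos ht _
  have htp2 : 0 < t ^ ν := Real.rpow_pos_of_pos ht _
  rw [← mul_assoc, ← mul_assoc, ENNReal.ofReal_rpow_of_pos htp,
    ENNReal.ofReal_rpow_of_pos (by positivity), ← ENNReal.ofReal_mul (by positivity),
    ← ENNReal.ofReal_mul (by positivity)]
  congr 2
  rw [div_eq_mul_inv, Real.mul_rpow htp2.le (by positivity), ← Real.rpow_mul ht.le,
    ← Real.rpow_mul ht.le, ← mul_assoc, ← Real.rpow_add ht, mul_comm]
  congr 2
  ring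

lemma coreB (ν : ℝ) (hν : 0 < ν) (G : ℝ → ℝ≥0∞) (hG : Measurable G) (p : ℝ) (hp : 1 ≤ p)
    (t : ℝ) (ht : 0 < t) :
    Hop ν G t ^ p ≤ ENNReal.ofReal (ν⁻¹ ^ (p - 1)) *
      ∫⁻ u in Ioi 0, ENNReal.ofReal (u ^ (-1 : ℝ)) * G u ^ p := by
  refine (coreA ν hν G hG p hp t ht).trans ?_
  gcongr
  rw [← lintegral_const_mul' _ _ ENNReal.ofReal_ne_top]
  calc _ ≤ ∫⁻ u in Ioo 0 t, ENNReal.ofReal (u ^ (-1 : ℝ)) * G u ^ p := by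
        refine setLIntegral_mono' measurableSet_Ioo fun u hu => ?_
        rw [← mul_assoc, ← ENNReal.ofReal_mul (Real.rpow_nonneg ht.le _)]
        gcongr
        have h1 : u ^ (ν - 1) = u ^ ν * u ^ (-1 : ℝ) := by
          rw [← Real.rpow_add hu.1]; rfl
        have h2 : u ^ ν ≤ t ^ ν := Real.rpow_le_rpow hu.1.le hu.2.le hν.le
        have h3 : t ^ (-ν) * t ^ ν = 1 := by rw [← Real.rpow_add ht]; simp
        have h4 : 0 ≤ u ^ (-1 : ℝ) := Real.rpow_nonneg hu.1.le _
        calc t ^ (-ν) * u ^ (ν - 1) ≤ t ^ (-ν) * (t ^ ν * u ^ (-1 : ℝ)) := by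
              rw [h1]; gcongr
          _ = u ^ (-1 : ℝ) := by rw [← mul_assoc, h3, one_mul]
    _ ≤ _ := lintegral_mono_set fun u hu => hu.1

lemma coreC (ν : ℝ) (hν : 0 < ν) (G : ℝ → ℝ≥0∞) (hG : Measurable G) (p : ℝ) (hp : 1 ≤ p) :
    ∫⁻ t in Ioi 0, ENNReal.ofReal (t ^ (-1 : ℝ)) * Hop ν G t ^ p ≤
      ENNReal.ofReal (ν⁻¹ ^ (p - 1)) * (ENNReal.ofReal ν⁻¹ *
      ∫⁻ u in Ioi 0, ENNReal.ofReal (u ^ (-1 : ℝ)) * G u ^ p) := by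
  set W : ℝ → ℝ≥0∞ := fun u => ENNReal.ofReal (u ^ (ν - 1)) * G u ^ p with hW
  have hWm : Measurable W := (meas_w _).mul (hG.pow_const p)
  have step1 : ∀ t ∈ Ioi (0:ℝ), ENNReal.ofReal (t ^ (-1 : ℝ)) * Hop ν G t ^ p ≤
      ENNReal.ofReal (ν⁻¹ ^ (p - 1)) *
        ∫⁻ u in Ioi 0, (Ioi u).indicator (fun t => ENNReal.ofReal (t ^ (-ν - 1))) t * W u := by
    intro t ht
    have ht : 0 < t := ht
    refine (mul_le_mul_right (coreA ν hν G hG p hp t ht) _).trans (le_of_eq ?_)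
    rw [mul_left_comm]
    congr 1
    rw [← mul_assoc, ← ENNReal.ofReal_mul (Real.rpow_nonneg ht.le _), ← Real.rpow_add ht,
      ← lintegral_const_mul _ hWm, ← lintegral_indicator measurableSet_Ioo,
      ← lintegral_indicator measurableSet_Ioi]
    congr 1
    ext u
    by_cases hu : 0 < u <;> by_cases hut : u < t <;> simp [hu, hut, indicator, hW]
    congr 3
    ring
  calc _ ≤ ∫⁻ t in Ioi 0, ENNReal.ofReal (ν⁻¹ ^ (p - 1)) *
        ∫⁻ u in Ioi 0, (Ioi u).indicator (fun t => ENNReal.ofReal (t ^ (-ν - 1))) t * W u :=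
        setLIntegral_mono' measurableSet_Ioi step1
    _ = ENNReal.ofReal (ν⁻¹ ^ (p - 1)) * ∫⁻ t in Ioi 0,
        ∫⁻ u in Ioi 0, (Ioi u).indicator (fun t => ENNReal.ofReal (t ^ (-ν - 1))) t * W u :=
        lintegral_const_mul' _ _ ENNReal.ofReal_ne_top
    _ = ENNReal.ofReal (ν⁻¹ ^ (p - 1)) * ∫⁻ u in Ioi 0,
        ∫⁻ t in Ioi 0, (Ioi u).indicator (fun t => ENNReal.ofReal (t ^ (-ν - 1))) t * W u := by
        rw [lintegral_lintegral_swap]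
        refine Measurable.aemeasurable ?_
        refine Measurable.mul ?_ (hWm.comp measurable_snd)
        have : Measurable ({q : ℝ × ℝ | q.2 < q.1}.indicator
            (fun q : ℝ × ℝ => ENNReal.ofReal (q.1 ^ (-ν - 1)))) :=
          ((meas_w _).comp measurable_fst).indicator (measurableSet_lt measurable_snd measurable_fst)
        exact this
    _ = ENNReal.ofReal (ν⁻¹ ^ (p - 1)) * ∫⁻ u in Ioi 0, ENNReal.ofReal ν⁻¹ *
          (ENNReal.ofReal (u ^ (-1 : ℝ)) * G u ^ p) := by
        congr 1
        refine setLIntegral_congr_fun measurableSet_Ioi fun u hu => ?_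
        have hu : 0 < u := hu
        rw [lintegral_mul_const _ ((meas_w _).indicator measurableSet_Ioi),
          setLIntegral_indicator measurableSet_Ioi,
          show Ioi u ∩ Ioi 0 = Ioi u from inter_eq_left.2 (Ioi_subset_Ioi hu.le),
          lint_Ioi ν hν u hu, hW]
        simp only
        rw [← mul_assoc, ← mul_assoc, ← ENNReal.ofReal_mul (by positivity),
          ← ENNReal.ofReal_mul (by positivity)]
        congr 2
        rw [div_mul_eq_mul_div, ← Real.rpow_add hu, div_eq_inv_mul]
        congr 2
        ring
    _ = _ := by rw [lintegral_const_mul' _ _ ENNReal.ofReal_ne_top]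

lemma elp_mono (s : ℝ≥0∞) (F F' : ℝ → ℝ≥0∞) (h : ∀ t ∈ Ioi (0:ℝ), F t ≤ F' t) :
    elp s (Ioi 0) F ≤ elp s (Ioi 0) F' := by
  unfold elp
  split_ifs
  · exact essSup_mono_ae ((ae_restrict_mem measurableSet_Ioi).mono h)
  · refine ENNReal.rpow_le_rpow ?_ (by positivity)
    exact setLIntegral_mono' measurableSet_Ioi fun t ht =>
      ENNReal.rpow_le_rpow (h t ht) (by positivity)

lemma elp_const (s : ℝ≥0∞) (hs : 1 ≤ s) (c : ℝ≥0∞) (hc : c ≠ ⊤) (F : ℝ → ℝ≥0∞) :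
    elp s (Ioi 0) (fun t => c * F t) = c * elp s (Ioi 0) F := by
  unfold elp
  split_ifs with h
  · exact ENNReal.essSup_const_mul
  · have hs0 : 0 < s.toReal := ENNReal.toReal_pos (by positivity) h
    simp_rw [ENNReal.mul_rpow_of_nonneg _ _ hs0.le]
    rw [lintegral_const_mul' _ _ (ENNReal.rpow_ne_top_of_nonneg hs0.le hc),
      ENNReal.mul_rpow_of_nonneg _ _ (by positivity), ← ENNReal.rpow_mul,
      mul_inv_cancel₀ hs0.ne', ENNReal.rpow_one]

lemma elp_fin (s : ℝ≥0∞) (hs : 1 ≤ s) (hs' : s ≠ ⊤) (F : ℝ → ℝ≥0∞) :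
    elp s (Ioi 0) (fun t => ENNReal.ofReal (t ^ (-s.toReal⁻¹)) * F t) =
      (∫⁻ t in Ioi 0, ENNReal.ofReal (t ^ (-1 : ℝ)) * F t ^ s.toReal) ^ s.toReal⁻¹ := by
  have hs0 : 0 < s.toReal := ENNReal.toReal_pos (by positivity) hs'
  rw [elp, if_neg hs']
  congr 1
  refine setLIntegral_congr_fun measurableSet_Ioi fun t ht => ?_
  have ht : 0 < t := ht
  rw [ENNReal.mul_rpow_of_nonneg _ _ hs0.le, ENNReal.ofReal_rpow_of_pos (by positivity),
    ← Real.rpow_mul ht.le, neg_mul, inv_mul_cancel₀ hs0.ne']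

lemma elp_top (F : ℝ → ℝ≥0∞) :
    elp ⊤ (Ioi 0) (fun t => ENNReal.ofReal (t ^ (-(⊤:ℝ≥0∞).toReal⁻¹)) * F t) =
      essSup F (volume.restrict (Ioi 0)) := by
  simp [elp]

lemma core (r s : ℝ≥0∞) (hr : 1 ≤ r) (hrs : r ≤ s) (ν : ℝ) (hν : 0 < ν) :
    ∃ C : ℝ≥0∞, C ≠ ⊤ ∧ ∀ G : ℝ → ℝ≥0∞, Measurable G →
      elp s (Ioi 0) (fun t => ENNReal.ofReal (t ^ (-s.toReal⁻¹)) * Hop ν G t) ≤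
        C * elp r (Ioi 0) (fun t => ENNReal.ofReal (t ^ (-r.toReal⁻¹)) * G t) := by
  by_cases hrt : r = ⊤
  · subst hrt
    obtain rfl : s = ⊤ := top_le_iff.1 hrs
    refine ⟨ENNReal.ofReal ν⁻¹, ENNReal.ofReal_ne_top, fun G hG => ?_⟩
    rw [elp_top, elp_top]
    refine essSup_le_of_ae_le _ ((ae_restrict_mem measurableSet_Ioi).mono fun t ht => ?_)
    have ht : 0 < t := ht
    set M := essSup G (volume.restrict (Ioi 0)) with hM
    calc Hop ν G t ≤ ENNReal.ofReal (t ^ (-ν)) *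
          ∫⁻ u in Ioo 0 t, ENNReal.ofReal (u ^ (ν - 1)) * M := by
          unfold Hop
          refine mul_le_mul_right (lintegral_mono_ae ?_) _
          have h := ENNReal.ae_le_essSup (μ := volume.restrict (Ioi (0:ℝ))) G
          have h' := ae_restrict_of_ae_restrict_of_subset
            (show Ioo 0 t ⊆ Ioi 0 from fun u hu => hu.1) h
          exact h'.mono fun u hu => mul_le_mul_right hu _
      _ = ENNReal.ofReal ν⁻¹ * M := by
          rw [lintegral_mul_const _ (meas_w _), lint_Ioo ν hν t ht, ← mul_assoc,
            ← ENNReal.ofReal_mul (by positivity)]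
          congr 2
          rw [← mul_div_assoc, ← Real.rpow_add ht]
          simp
  · set p := r.toReal with hpdef
    have hp : 1 ≤ p := by
      simpa using ENNReal.toReal_mono hrt hr
    have hp0 : 0 < p := by linarith
    set A : ℝ≥0∞ := max 1 (max (ENNReal.ofReal (ν⁻¹ ^ (p - 1)))
      (ENNReal.ofReal (ν⁻¹ ^ (p - 1)) * ENNReal.ofReal ν⁻¹)) with hA
    have hA1 : ENNReal.ofReal (ν⁻¹ ^ (p - 1)) ≤ A := (le_max_left _ _).trans (le_max_right _ _)
    have hA2 : ENNReal.ofReal (ν⁻¹ ^ (p - 1)) * ENNReal.ofReal ν⁻¹ ≤ A :=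
      (le_max_right _ _).trans (le_max_right _ _)
    have hAt : A ≠ ⊤ := by
      simp [hA, ENNReal.mul_eq_top]
    have hA0 : A ≠ 0 := (lt_of_lt_of_le one_pos (le_max_left _ _)).ne'
    refine ⟨A ^ p⁻¹, ENNReal.rpow_ne_top_of_nonneg (by positivity) hAt, fun G hG => ?_⟩
    rw [elp_fin r hr hrt, ← hpdef, ← ENNReal.mul_rpow_of_nonneg _ _ (by positivity)]
    set N := ∫⁻ u in Ioi 0, ENNReal.ofReal (u ^ (-1 : ℝ)) * G u ^ p with hN
    have hB : ∀ t ∈ Ioi (0:ℝ), Hop ν G t ≤ (A * N) ^ p⁻¹ := by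
      intro t ht
      rw [ENNReal.le_rpow_inv_iff hp0]
      exact (coreB ν hν G hG p hp t ht).trans (mul_le_mul_left hA1 _)
    by_cases hst : s = ⊤
    · subst hst
      rw [elp_top]
      exact essSup_le_of_ae_le _ ((ae_restrict_mem measurableSet_Ioi).mono hB)
    · rw [elp_fin s (hr.trans hrs) hst]
      have hpq : p ≤ s.toReal := ENNReal.toReal_mono hst hrs
      set q := s.toReal
      have hq0 : 0 < q := by linarith
      by_cases hNt : A * N = ⊤
      · rw [hNt, ENNReal.top_rpow_of_pos (by positivity)]; exact le_top
      have hC : ∫⁻ t in Ioi 0, ENNReal.ofReal (t ^ (-1 : ℝ)) * Hop ν G t ^ p ≤ A * N := by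
        refine (coreC ν hν G hG p hp).trans ?_
        rw [← mul_assoc]
        exact mul_le_mul_left hA2 _
      rw [ENNReal.rpow_inv_le_iff hq0]
      have hc : ((A * N) ^ p⁻¹) ^ (q - p) ≠ ⊤ :=
        ENNReal.rpow_ne_top_of_nonneg (by linarith)
          (ENNReal.rpow_ne_top_of_nonneg (by positivity) hNt)
      calc _ ≤ ∫⁻ t in Ioi 0, ((A * N) ^ p⁻¹) ^ (q - p) *
            (ENNReal.ofReal (t ^ (-1 : ℝ)) * Hop ν G t ^ p) := by
            refine setLIntegral_mono' measurableSet_Ioi fun t ht => ?_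
            have : Hop ν G t ^ q = Hop ν G t ^ (q - p) * Hop ν G t ^ p := by
              rw [← ENNReal.rpow_add_of_nonneg _ _ (by linarith) hp0.le, sub_add_cancel]
            rw [this, mul_left_comm]
            refine mul_le_mul_left (ENNReal.rpow_le_rpow (hB t ht) (by linarith)) _
        _ = ((A * N) ^ p⁻¹) ^ (q - p) *
            ∫⁻ t in Ioi 0, ENNReal.ofReal (t ^ (-1 : ℝ)) * Hop ν G t ^ p :=
            lintegral_const_mul' _ _ hc
        _ ≤ ((A * N) ^ p⁻¹) ^ (q - p) * ((A * N) ^ p⁻¹) ^ p := by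
            rw [ENNReal.rpow_inv_rpow hp0.ne']
            exact mul_le_mul_right hC _
        _ = ((A * N) ^ p⁻¹) ^ q := by
            rw [← ENNReal.rpow_add_of_nonneg _ _ (by linarith) hp0.le, sub_add_cancel]

theorem stmt8 (r s : ℝ≥0∞) (hr : 1 ≤ r) (hrs : r ≤ s)
    (a b : ℝ → ℝ) (ha0 : ∀ t ∈ Set.Ioi (0:ℝ), 0 ≤ a t) (hb0 : ∀ t ∈ Set.Ioi (0:ℝ), 0 ≤ b t)
    (hsva : SlowlyVaryingOn a (Set.Ioi 0)) (hsvb : SlowlyVaryingOn b (Set.Ioi 0))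
    (μ κ : ℝ) (hμ : 0 < μ)
    (hN : ∃ K : ℝ, ∀ x ∈ Set.Ioi (0:ℝ), b x ≤ K * a x) :
    ∃ C : ℝ, 0 < C ∧ ∀ g : ℝ → ℝ, Measurable g → (∀ u, 0 ≤ g u) →
      elp s (Set.Ioi 0) (fun t => ENNReal.ofReal (t ^ (-μ - s.toReal⁻¹) * b t) *
          ∫⁻ u in Set.Ioo 0 t, ENNReal.ofReal (u ^ (κ - 1) * g u)) ≤
        ENNReal.ofReal C *
          elp r (Set.Ioi 0) (fun t => ENNReal.ofReal (t ^ (-μ + κ - r.toReal⁻¹) * a t * g t)) := by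
  obtain ⟨K₀, hK₀⟩ := hN
  obtain ⟨K, hK0, hK⟩ : ∃ K : ℝ, 0 ≤ K ∧ ∀ x ∈ Set.Ioi (0:ℝ), b x ≤ K * a x :=
    ⟨max K₀ 0, le_max_right _ _, fun x hx => (hK₀ x hx).trans
      (mul_le_mul_of_nonneg_right (le_max_left _ _) (ha0 x hx))⟩
  set ν := μ / 2 with hνd
  have hν : 0 < ν := by positivity
  have hμν : μ = ν + ν := by rw [hνd]; ring
  obtain ⟨g₁, g₂, -, hg₂, c₁, c₂, hc₁, hc₂, hc⟩ := hsva ν hν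
  have hg0 : ∀ t, 0 < t → 0 ≤ g₂ t := fun t ht => by
    have h1 := (hc t ht).2.2.2
    have h2 : 0 ≤ t ^ (-ν) * a t := mul_nonneg (Real.rpow_nonneg ht.le _) (ha0 t ht)
    exact nonneg_of_mul_nonneg_right (h2.trans h1) hc₂
  have hinv : ∀ t : ℝ, 0 < t → t ^ ν * t ^ (-ν) = 1 := fun t ht => by
    rw [← Real.rpow_add ht]; simp
  have hb : ∀ t, 0 < t → b t ≤ K * c₂ * (t ^ ν * g₂ t) := fun t ht => by
    calc b t ≤ K * a t := hK t ht
      _ = K * (t ^ ν * (t ^ (-ν) * a t)) := by rw [← mul_assoc (t ^ ν), hinv t ht, one_mul]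
      _ ≤ K * (t ^ ν * (c₂ * g₂ t)) := by
          have := (hc t ht).2.2.2
          gcongr
      _ = _ := by ring
  have hgm : Measurable ((Ioi (0:ℝ)).indicator g₂) := by
    refine measurable_of_restrict_of_restrict_compl (measurableSet_Ioi (a := (0:ℝ))) ?_ ?_
    · have : Antitone ((Ioi (0:ℝ)).domRestrict ((Ioi (0:ℝ)).indicator g₂)) := fun x y hxy => by
        have h := hg₂ x.2 y.2 hxy
        rwa [Set.domRestrict_apply, Set.domRestrict_apply, indicator_of_mem x.2,
          indicator_of_mem y.2]
      exact this.measurable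
    · have : (Ioi (0:ℝ))ᶜ.domRestrict ((Ioi (0:ℝ)).indicator g₂) = fun _ => 0 := by
        ext x
        exact indicator_of_notMem x.2 _
      rw [this]
      exact measurable_const
  obtain ⟨C, hCt, hC⟩ := core r s hr hrs ν hν
  set D : ℝ≥0∞ := ENNReal.ofReal (K * c₂) * C * ENNReal.ofReal c₁⁻¹ with hD
  have hDt : D ≠ ⊤ := by
    exact ENNReal.mul_ne_top (ENNReal.mul_ne_top ENNReal.ofReal_ne_top hCt) ENNReal.ofReal_ne_top
  refine ⟨D.toReal + 1, by positivity, fun g hg hgn => ?_⟩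
  have hDle : D ≤ ENNReal.ofReal (D.toReal + 1) := by
    rw [ENNReal.le_ofReal_iff_toReal_le hDt (by positivity)]; linarith
  refine le_trans ?_ (mul_le_mul_left hDle _)
  set G : ℝ → ℝ≥0∞ := fun u =>
    ENNReal.ofReal (u ^ (κ - ν) * (Ioi (0:ℝ)).indicator g₂ u * g u) with hGd
  have hGm : Measurable G := by fun_prop
  have hGe : ∀ u, 0 < u → G u = ENNReal.ofReal (u ^ (κ - ν) * g₂ u * g u) := fun u hu => by
    simp only [hGd]
    rw [indicator_of_mem (show u ∈ Ioi (0:ℝ) from hu)]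
  have L : elp s (Set.Ioi 0) (fun t => ENNReal.ofReal (t ^ (-μ - s.toReal⁻¹) * b t) *
          ∫⁻ u in Set.Ioo 0 t, ENNReal.ofReal (u ^ (κ - 1) * g u)) ≤
      ENNReal.ofReal (K * c₂) *
        elp s (Ioi 0) (fun t => ENNReal.ofReal (t ^ (-s.toReal⁻¹)) * Hop ν G t) := by
    rw [← elp_const s (hr.trans hrs) _ ENNReal.ofReal_ne_top]
    refine elp_mono _ _ _ fun t ht => ?_
    have ht : 0 < t := ht
    have e1 : t ^ (-μ - s.toReal⁻¹) * b t ≤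
        K * c₂ * (t ^ (-s.toReal⁻¹) * (t ^ (-ν) * g₂ t)) := by
      have e : t ^ (-μ - s.toReal⁻¹) * t ^ ν = t ^ (-s.toReal⁻¹) * t ^ (-ν) := by
        rw [← Real.rpow_add ht, ← Real.rpow_add ht, hμν]; congr 1; ring
      calc _ ≤ t ^ (-μ - s.toReal⁻¹) * (K * c₂ * (t ^ ν * g₂ t)) := by
            have := hb t ht
            gcongr
        _ = K * c₂ * ((t ^ (-μ - s.toReal⁻¹) * t ^ ν) * g₂ t) := by ring
        _ = _ := by rw [e]; ring
    calc _ ≤ ENNReal.ofReal (K * c₂ * (t ^ (-s.toReal⁻¹) * (t ^ (-ν) * g₂ t))) *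
          ∫⁻ u in Set.Ioo 0 t, ENNReal.ofReal (u ^ (κ - 1) * g u) := by gcongr
      _ = ENNReal.ofReal (K * c₂) * (ENNReal.ofReal (t ^ (-s.toReal⁻¹)) *
          (ENNReal.ofReal (t ^ (-ν)) * (ENNReal.ofReal (g₂ t) *
          ∫⁻ u in Set.Ioo 0 t, ENNReal.ofReal (u ^ (κ - 1) * g u)))) := by
          rw [ENNReal.ofReal_mul (by positivity), ENNReal.ofReal_mul (by positivity),
            ENNReal.ofReal_mul (by positivity), ENNReal.ofReal_mul (by positivity)]
          simp only [mul_assoc]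
      _ ≤ _ := by
          unfold Hop
          refine mul_le_mul_right (mul_le_mul_right (mul_le_mul_right ?_ _) _) _
          rw [← lintegral_const_mul' _ _ ENNReal.ofReal_ne_top]
          refine setLIntegral_mono' measurableSet_Ioo fun u hu => ?_
          have hu0 : 0 < u := hu.1
          rw [hGe u hu0, ← ENNReal.ofReal_mul (hg0 t ht), ← ENNReal.ofReal_mul (by positivity)]
          refine ENNReal.ofReal_le_ofReal ?_
          have e : u ^ (ν - 1) * u ^ (κ - ν) = u ^ (κ - 1) := by
            rw [← Real.rpow_add hu0]; congr 1; ring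
          have h1 : g₂ t ≤ g₂ u := hg₂ hu0 ht hu.2.le
          calc _ ≤ g₂ u * (u ^ (κ - 1) * g u) :=
                mul_le_mul_of_nonneg_right h1 (mul_nonneg (by positivity) (hgn u))
            _ = _ := by rw [← e]; ring
  have R : elp r (Ioi 0) (fun t => ENNReal.ofReal (t ^ (-r.toReal⁻¹)) * G t) ≤
      ENNReal.ofReal c₁⁻¹ *
        elp r (Set.Ioi 0) (fun t => ENNReal.ofReal (t ^ (-μ + κ - r.toReal⁻¹) * a t * g t)) := by
    rw [← elp_const r hr _ ENNReal.ofReal_ne_top]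
    refine elp_mono _ _ _ fun t ht => ?_
    have ht : 0 < t := ht
    rw [hGe t ht, ← ENNReal.ofReal_mul (by positivity), ← ENNReal.ofReal_mul (by positivity)]
    refine ENNReal.ofReal_le_ofReal ?_
    have h1 : g₂ t ≤ c₁⁻¹ * (t ^ (-ν) * a t) := by
      rw [le_inv_mul_iff₀ hc₁]; exact (hc t ht).2.2.1
    have e : t ^ (-r.toReal⁻¹) * t ^ (κ - ν) * t ^ (-ν) = t ^ (-μ + κ - r.toReal⁻¹) := by
      rw [← Real.rpow_add ht, ← Real.rpow_add ht, hμν]; congr 1; ring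
    have hgt := hgn t
    calc _ ≤ t ^ (-r.toReal⁻¹) * (t ^ (κ - ν) * (c₁⁻¹ * (t ^ (-ν) * a t)) * g t) := by gcongr
      _ = _ := by rw [← e]; ring
  calc _ ≤ _ := L
    _ ≤ ENNReal.ofReal (K * c₂) * (C * (ENNReal.ofReal c₁⁻¹ * _)) :=
        mul_le_mul_right ((hC G hGm).trans (mul_le_mul_right R _)) _
    _ = _ := by rw [hD]; simp only [mul_assoc]
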